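/- arXiv:2408.09294 — 3 statements merged into one kernel-verified Lean document; each statement's English description precedes it below -/
import Mathlib

section
/- If a continuous action â is b-superior to a, then: (i) for every θ ∈ 𝒞, â(θ) ≥ a(θ); (ii) for every θ ∈ 𝒜, â(θ) > b(θ); and (iii) â pairwise-dominates a collection of mixtures of a and b, i.e. for every pair (θ, θ′) ∈ 𝒜 × ℬ there exists λ ∈ [0,1] such that â(θ) ≥ λ·a(θ) + (1−λ)·b(θ) and â(θ′) ≥ λ·a(θ′) + (1−λ)·b(θ′). -/
open MeasureTheory

/-- Action `ahat` is b-superior to `a`: for every strictly increasing, concave,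
continuous utility and every Borel probability measure (belief), preferring `a`
to `b` (weakly/strictly) implies preferring `ahat` to `b` (weakly/strictly). -/
def BSuperior {Θ : Type*} [TopologicalSpace Θ] [MeasurableSpace Θ]
    (a b ahat : C(Θ, ℝ)) : Prop :=
  ∀ u : ℝ → ℝ, StrictMono u → ConcaveOn ℝ Set.univ u → Continuous u →
    ∀ μ : Measure Θ, IsProbabilityMeasure μ →
      ((∫ θ, u (a θ) ∂μ) ≥ (∫ θ, u (b θ) ∂μ) →
        (∫ θ, u (ahat θ) ∂μ) ≥ (∫ θ, u (b θ) ∂μ)) ∧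
      ((∫ θ, u (a θ) ∂μ) > (∫ θ, u (b θ) ∂μ) →
        (∫ θ, u (ahat θ) ∂μ) > (∫ θ, u (b θ) ∂μ))

theorem integral_two_dirac {Θ : Type*} [TopologicalSpace Θ]
    [TopologicalSpace.MetrizableSpace Θ] [MeasurableSpace Θ] [BorelSpace Θ]
    (f : Θ → ℝ) (θ θ' : Θ) {p q : ℝ} (hp : 0 ≤ p) (hq : 0 ≤ q) :
    ∫ t, f t ∂(ENNReal.ofReal p • Measure.dirac θ + ENNReal.ofReal q • Measure.dirac θ')
      = p * f θ + q * f θ' := by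
  rw [integral_add_measure]
  · simp [integral_smul_measure, hp, hq]
  · exact (integrable_dirac (by simp)).smul_measure (by simp)
  · exact (integrable_dirac (by simp)).smul_measure (by simp)

/-- Applying b-superiority to the two-point belief that makes `u` indifferent between `a` and `b`. -/
theorem BSuperior.mul_sub_le_mul_sub {Θ : Type*} [TopologicalSpace Θ]
    [TopologicalSpace.MetrizableSpace Θ] [MeasurableSpace Θ] [BorelSpace Θ]
    {a b ahat : C(Θ, ℝ)} (hsup : BSuperior a b ahat) {u : ℝ → ℝ} (hu : StrictMono u)
    (hconc : ConcaveOn ℝ Set.univ u) (hcont : Continuous u) {θ θ' : Θ}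
    (hθ : b θ < a θ) (hθ' : a θ' < b θ') :
    (u (b θ') - u (ahat θ')) * (u (a θ) - u (b θ)) ≤
      (u (ahat θ) - u (b θ)) * (u (b θ') - u (a θ')) := by
  have hC := hu hθ
  have hD := hu hθ'
  set C := u (a θ) - u (b θ) with hCdef
  set D := u (b θ') - u (a θ') with hDdef
  have hC0 : 0 < C := sub_pos.2 hC
  have hD0 : 0 < D := sub_pos.2 hD
  have hp : 0 ≤ D / (C + D) := by positivity
  have hq : 0 ≤ C / (C + D) := by positivity
  have hμ : IsProbabilityMeasure (ENNReal.ofReal (D / (C + D)) • Measure.dirac θ +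
      ENNReal.ofReal (C / (C + D)) • Measure.dirac θ') := by
    refine ⟨?_⟩
    simp only [Measure.add_apply, Measure.smul_apply, measure_univ, smul_eq_mul, mul_one]
    rw [← ENNReal.ofReal_add hp hq, ← add_div, add_comm D C, div_self (by positivity),
      ENNReal.ofReal_one]
  have h := (hsup u hu hconc hcont _ hμ).1
  simp only [integral_two_dirac (fun t => u (a t)) θ θ' hp hq,
    integral_two_dirac (fun t => u (b t)) θ θ' hp hq,
    integral_two_dirac (fun t => u (ahat t)) θ θ' hp hq, ge_iff_le] at h
  have key (x y : ℝ) : D / (C + D) * u (b θ) + C / (C + D) * u (b θ') ≤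
      D / (C + D) * x + C / (C + D) * y ↔
      (u (b θ') - y) * C ≤ (x - u (b θ)) * D := by
    rw [div_mul_eq_mul_div, div_mul_eq_mul_div, div_mul_eq_mul_div, div_mul_eq_mul_div,
      ← add_div, ← add_div, div_le_div_iff_of_pos_right (by positivity)]
    constructor <;> intro h <;> linarith
  rw [key, key] at h
  exact h (by rw [← hCdef, ← hDdef, mul_comm])

/-- The increment from `b` to `x` is at most `(x - b + (a - b)) / (a - b)` times that to `a`. -/
theorem ConcaveOn.sub_mul_le_mul_sub {u : ℝ → ℝ} (hu : StrictMono u)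
    (hconc : ConcaveOn ℝ Set.univ u) {a b x : ℝ} (hab : b < a) (hbx : b < x) :
    (u x - u b) * (a - b) ≤ (x - b + (a - b)) * (u a - u b) := by
  have ha : 0 < a - b := sub_pos.2 hab
  have hx : 0 < x - b := sub_pos.2 hbx
  have hs : 0 ≤ (a - b) / (x - b + (a - b)) := by positivity
  have ht : 0 ≤ (x - b) / (x - b + (a - b)) := by positivity
  have hst : (a - b) / (x - b + (a - b)) + (x - b) / (x - b + (a - b)) = 1 := by
    rw [← add_div, add_comm (a - b), div_self (by positivity)]
  have h := hconc.2 (Set.mem_univ x) (Set.mem_univ b) hs ht hst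
  have hle : ((a - b) / (x - b + (a - b))) • x + ((x - b) / (x - b + (a - b))) • b ≤ a := by
    rw [smul_eq_mul, smul_eq_mul, div_mul_eq_mul_div, div_mul_eq_mul_div, ← add_div,
      div_le_iff₀ (by positivity)]
    nlinarith [mul_pos ha ha]
  have h' := h.trans (hu.monotone hle)
  rw [smul_eq_mul, smul_eq_mul, div_mul_eq_mul_div, div_mul_eq_mul_div, ← add_div,
    div_le_iff₀ (by positivity)] at h'
  linarith

/-- The utility with slope `1 + M` below `c` and slope `1` above it. -/
def kinkedUtility (M c t : ℝ) : ℝ := t + M * min (t - c) 0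

theorem kinkedUtility_strictMono {M : ℝ} (hM : 0 ≤ M) (c : ℝ) :
    StrictMono (kinkedUtility M c) := by
  intro s t hst
  unfold kinkedUtility
  exact add_lt_add_of_lt_of_le hst (by gcongr)

theorem kinkedUtility_concaveOn {M : ℝ} (hM : 0 ≤ M) (c : ℝ) :
    ConcaveOn ℝ Set.univ (kinkedUtility M c) := by
  have hid : ConcaveOn ℝ Set.univ (fun t : ℝ => t) := concaveOn_id convex_univ
  exact hid.add (((hid.sub (convexOn_const c convex_univ)).inf (concaveOn_const 0 convex_univ)).smul hM)

theorem kinkedUtility_continuous (M c : ℝ) : Continuous (kinkedUtility M c) := by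
  unfold kinkedUtility
  fun_prop

/-- Where `b` beats `a`, a b-superior action is at least as good as `a`. -/
theorem BSuperior.le_of_lt {Θ : Type*} [TopologicalSpace Θ]
    [TopologicalSpace.MetrizableSpace Θ] [MeasurableSpace Θ] [BorelSpace Θ]
    {a b ahat : C(Θ, ℝ)} (hsup : BSuperior a b ahat) {θ θ' : Θ}
    (hθ : b θ < a θ) (hx : b θ < ahat θ) (hθ' : a θ' < b θ') : a θ' ≤ ahat θ' := by
  by_contra! hy
  have ha : 0 < a θ - b θ := sub_pos.2 hθ
  have hx0 : 0 < ahat θ - b θ := sub_pos.2 hx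
  have hb : 0 < b θ' - a θ' := sub_pos.2 hθ'
  have hy0 : 0 < a θ' - ahat θ' := sub_pos.2 hy
  set K := (ahat θ - b θ + (a θ - b θ)) / (a θ - b θ) with hK
  have hK0 : 0 < K := by positivity
  set M := K * (b θ' - a θ') / (a θ' - ahat θ') with hMdef
  have hM : 0 ≤ M := by positivity
  have hmono := kinkedUtility_strictMono hM (a θ')
  have hconc := kinkedUtility_concaveOn hM (a θ')
  have h := hsup.mul_sub_le_mul_sub hmono hconc (kinkedUtility_continuous M (a θ')) hθ hθ'
  have hscale := hconc.sub_mul_le_mul_sub hmono hθ hx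
  have hC := sub_pos.2 (hmono hθ)
  set C := kinkedUtility M (a θ') (a θ) - kinkedUtility M (a θ') (b θ)
  have hKC : kinkedUtility M (a θ') (ahat θ) - kinkedUtility M (a θ') (b θ) ≤ K * C := by
    rw [hK, div_mul_eq_mul_div, le_div_iff₀ ha]
    exact hscale
  have hD : kinkedUtility M (a θ') (b θ') - kinkedUtility M (a θ') (a θ') = b θ' - a θ' := by
    simp [kinkedUtility, hθ'.le]
  have hE : kinkedUtility M (a θ') (b θ') - kinkedUtility M (a θ') (ahat θ') =
      b θ' - ahat θ' + K * (b θ' - a θ') := by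
    have hMy : M * (a θ' - ahat θ') = K * (b θ' - a θ') := div_mul_cancel₀ _ hy0.ne'
    simp only [kinkedUtility, min_eq_right (sub_nonneg.2 hθ'.le),
      min_eq_left (sub_nonpos.2 hy.le)]
    linarith
  rw [hD, hE] at h
  have h2 := h.trans (mul_le_mul_of_nonneg_right hKC hb.le)
  have h3 : 0 < (b θ' - ahat θ') * C := mul_pos (by linarith) hC
  linarith

/-- Lemma 1: b-superiority implies (i) `ahat ≥ a` on 𝒞, (ii) `ahat > b` on 𝒜,
and (iii) `ahat` pairwise-dominates a collection of mixtures of `a` and `b`. -/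
theorem bSuperior_necessary {Θ : Type*} [TopologicalSpace Θ] [CompactSpace Θ]
    [TopologicalSpace.MetrizableSpace Θ] [MeasurableSpace Θ] [BorelSpace Θ]
    (a b ahat : C(Θ, ℝ))
    (hA : ∃ θ, a θ > b θ) (hB : ∃ θ, a θ < b θ)
    (hsup : BSuperior a b ahat) :
    (∀ θ, a θ = b θ → ahat θ ≥ a θ) ∧
    (∀ θ, a θ > b θ → ahat θ > b θ) ∧
    (∀ θ θ', a θ > b θ → a θ' < b θ' →
      ∃ l : ℝ, l ∈ Set.Icc (0 : ℝ) 1 ∧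
        ahat θ ≥ l * a θ + (1 - l) * b θ ∧
        ahat θ' ≥ l * a θ' + (1 - l) * b θ') := by
  have hid : ConcaveOn ℝ Set.univ (id : ℝ → ℝ) := concaveOn_id convex_univ
  have hdirac (θ : Θ) := hsup id strictMono_id hid continuous_id (Measure.dirac θ) inferInstance
  simp only [integral_dirac, id_eq] at hdirac
  have hpos (θ : Θ) (h : a θ > b θ) : ahat θ > b θ := (hdirac θ).2 h
  refine ⟨fun θ h => h ▸ (hdirac θ).1 h.ge, hpos, fun θ θ' h h' => ?_⟩
  have hx := hpos θ h
  have hy := hsup.le_of_lt h hx h'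
  have hD : 0 < b θ' - a θ' := sub_pos.2 h'
  rcases le_total (b θ') (ahat θ') with hb | hb
  · exact ⟨0, by simp, by linarith, by linarith⟩
  have hlin := hsup.mul_sub_le_mul_sub strictMono_id hid continuous_id h h'
  simp only [id_eq] at hlin
  have hl : (b θ' - ahat θ') / (b θ' - a θ') * (b θ' - a θ') = b θ' - ahat θ' :=
    div_mul_cancel₀ _ hD.ne'
  refine ⟨(b θ' - ahat θ') / (b θ' - a θ'),
    ⟨div_nonneg (sub_nonneg.2 hb) hD.le, (div_le_one hD).2 (by linarith)⟩, ?_, by linarith⟩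
  have : (b θ' - ahat θ') / (b θ' - a θ') * (a θ - b θ) ≤ ahat θ - b θ := by
    rwa [div_mul_eq_mul_div, div_le_iff₀ hD]
  linarith
end

section
/- Fix actions a and b with neither weakly dominating the other. A continuous action â is b-better than a if and only if (i) â(θ) > b(θ) for every θ ∈ 𝒜, and (ii) â weakly dominates a or â weakly dominates b state-wise, i.e. â(θ) ≥ a(θ) for every θ ∈ Θ, or â(θ) ≥ b(θ) for every θ ∈ Θ. -/
open MeasureTheory

/-- Action `ahat` is b-better than `a`: for every strictly increasing,
continuous (not necessarily concave) utility and every Borel probability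
measure (belief), preferring `a` to `b` (weakly/strictly) implies preferring
`ahat` to `b` (weakly/strictly). -/
def BBetter {Θ : Type*} [TopologicalSpace Θ] [MeasurableSpace Θ]
    (a b ahat : C(Θ, ℝ)) : Prop :=
  ∀ u : ℝ → ℝ, StrictMono u → Continuous u →
    ∀ μ : Measure Θ, IsProbabilityMeasure μ →
      ((∫ θ, u (a θ) ∂μ) ≥ (∫ θ, u (b θ) ∂μ) →
        (∫ θ, u (ahat θ) ∂μ) ≥ (∫ θ, u (b θ) ∂μ)) ∧
      ((∫ θ, u (a θ) ∂μ) > (∫ θ, u (b θ) ∂μ) →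
        (∫ θ, u (ahat θ) ∂μ) > (∫ θ, u (b θ) ∂μ))

/-- The expectation of a continuous function under a two-point belief. -/
theorem exists_isProbabilityMeasure_two_point {Θ : Type*} [TopologicalSpace Θ]
    [MeasurableSpace Θ] [BorelSpace Θ] (x y : Θ) {p : ℝ} (hp0 : 0 ≤ p) (hp1 : p ≤ 1) :
    ∃ μ : Measure Θ, IsProbabilityMeasure μ ∧
      ∀ f : C(Θ, ℝ), ∫ θ, f θ ∂μ = p * f x + (1 - p) * f y := by
  have hq : 0 ≤ 1 - p := sub_nonneg.2 hp1
  refine ⟨ENNReal.ofReal p • Measure.dirac x + ENNReal.ofReal (1 - p) • Measure.dirac y,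
    ⟨?_⟩, fun f => ?_⟩
  · simp [← ENNReal.ofReal_add hp0 hq]
  · have hint (z : Θ) : Integrable f (Measure.dirac z) :=
      ⟨f.continuous.stronglyMeasurable.aestronglyMeasurable, by
        simp [HasFiniteIntegral, lintegral_dirac' z f.continuous.measurable.enorm]⟩
    rw [integral_add_measure ((hint x).smul_measure ENNReal.ofReal_ne_top)
      ((hint y).smul_measure ENNReal.ofReal_ne_top), integral_smul_measure, integral_smul_measure,
      integral_dirac' _ _ f.continuous.stronglyMeasurable,
      integral_dirac' _ _ f.continuous.stronglyMeasurable,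
      ENNReal.toReal_ofReal hp0, ENNReal.toReal_ofReal hq, smul_eq_mul, smul_eq_mul]

/-- A polynomial of degree at most two with nonnegative leading coefficient and positive linear
coefficient takes a positive value at some nonnegative point. -/
theorem exists_nonneg_quadratic_pos (c₀ : ℝ) {c₁ c₂ : ℝ} (h₁ : 0 < c₁) (h₂ : 0 ≤ c₂) :
    ∃ K : ℝ, 0 ≤ K ∧ 0 < c₀ + c₁ * K + c₂ * K ^ 2 := by
  refine ⟨(|c₀| + 1) / c₁, by positivity, ?_⟩
  have h : c₁ * ((|c₀| + 1) / c₁) = |c₀| + 1 := by field_simp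
  have h' : 0 ≤ c₂ * ((|c₀| + 1) / c₁) ^ 2 := by positivity
  linarith [neg_abs_le c₀]

/-- If `b₁ < h₁ < a₁` and `a₂ < h₂ < b₂`, some utility makes the relative gain `h₁ - b₁` small
compared with the relative loss `b₂ - h₂`. -/
theorem exists_utility_of_lt_of_lt {a₁ b₁ h₁ a₂ b₂ h₂ : ℝ} (hb₁ : b₁ < h₁) (ha₁ : h₁ < a₁)
    (ha₂ : a₂ < h₂) (hb₂ : h₂ < b₂) :
    ∃ u : ℝ → ℝ, StrictMono u ∧ Continuous u ∧
      (u h₁ - u b₁) * (u b₂ - u a₂) < (u b₂ - u h₂) * (u a₁ - u b₁) := by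
  set m := max h₁ h₂ with hm
  have hm₁ : h₁ ≤ m := le_max_left _ _
  have hm₂ : h₂ ≤ m := le_max_right _ _
  set D₁ := max (a₁ - m) 0 with hD₁
  set D₂ := max (b₂ - m) 0 with hD₂
  have hD₁0 : 0 ≤ D₁ := le_max_right _ _
  have hD₂0 : 0 ≤ D₂ := le_max_right _ _
  have hc : 0 < D₂ * (a₁ - h₁) + D₁ * (b₂ - h₂) := by
    rcases max_choice h₁ h₂ with h | h
    · have : 0 < D₁ := lt_max_of_lt_left (by rw [hm, h]; linarith)
      nlinarith [mul_pos this (sub_pos.2 hb₂), mul_nonneg hD₂0 (sub_pos.2 ha₁).le]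
    · have : 0 < D₂ := lt_max_of_lt_left (by rw [hm, h]; linarith)
      nlinarith [mul_nonneg hD₁0 (sub_pos.2 hb₂).le, mul_pos this (sub_pos.2 ha₁)]
  obtain ⟨K, hK, hpos⟩ := exists_nonneg_quadratic_pos
    ((b₂ - h₂) * (a₁ - b₁) - (h₁ - b₁) * (b₂ - a₂)) hc (mul_nonneg hD₁0 hD₂0)
  refine ⟨fun t => t + K * max (t - m) 0, ?_, by fun_prop, ?_⟩
  · intro s t hst
    have : max (s - m) 0 ≤ max (t - m) 0 := max_le_max_right _ (by linarith)
    have := mul_le_mul_of_nonneg_left this hK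
    dsimp only
    linarith
  · simp only [max_eq_right (show h₁ - m ≤ 0 by linarith),
      max_eq_right (show b₁ - m ≤ 0 by linarith), max_eq_right (show h₂ - m ≤ 0 by linarith),
      max_eq_right (show a₂ - m ≤ 0 by linarith), ← hD₁, ← hD₂]
    linarith

/-- If `b₁ < a₁ ≤ h₁` and `h₂ < a₂ < b₂`, some utility makes the gain `h₁ - b₁` relative to
`a₁ - b₁` smaller than the loss `b₂ - h₂` relative to `b₂ - a₂`. -/
theorem exists_utility_of_le_of_lt {a₁ b₁ h₁ a₂ b₂ h₂ : ℝ} (hb₁ : b₁ < a₁) (ha₁ : a₁ ≤ h₁)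
    (ha₂ : h₂ < a₂) (hb₂ : a₂ < b₂) :
    ∃ u : ℝ → ℝ, StrictMono u ∧ Continuous u ∧
      (u h₁ - u b₁) * (u b₂ - u a₂) < (u b₂ - u h₂) * (u a₁ - u b₁) := by
  set m := min a₁ a₂ with hm
  have hm₁ : m ≤ a₁ := min_le_left _ _
  have hm₂ : m ≤ a₂ := min_le_right _ _
  set D₁ := max (m - b₁) 0 with hD₁
  set D₂ := max (m - h₂) 0 with hD₂
  have hD₁0 : 0 ≤ D₁ := le_max_right _ _
  have hD₂0 : 0 ≤ D₂ := le_max_right _ _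
  have hc : 0 < D₁ * (a₂ - h₂) + D₂ * (a₁ - b₁) := by
    rcases min_choice a₁ a₂ with h | h
    · have : 0 < D₁ := lt_max_of_lt_left (by rw [hm, h]; linarith)
      nlinarith [mul_pos this (sub_pos.2 ha₂), mul_nonneg hD₂0 (sub_pos.2 hb₁).le]
    · have : 0 < D₂ := lt_max_of_lt_left (by rw [hm, h]; linarith)
      nlinarith [mul_nonneg hD₁0 (sub_pos.2 ha₂).le, mul_pos this (sub_pos.2 hb₁)]
  obtain ⟨K, hK, hpos⟩ := exists_nonneg_quadratic_pos
    ((b₂ - h₂) * (a₁ - b₁) - (h₁ - b₁) * (b₂ - a₂)) hc (mul_nonneg hD₁0 hD₂0)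
  refine ⟨fun t => t - K * max (m - t) 0, ?_, by fun_prop, ?_⟩
  · intro s t hst
    have : max (m - t) 0 ≤ max (m - s) 0 := max_le_max_right _ (by linarith)
    have := mul_le_mul_of_nonneg_left this hK
    dsimp only
    linarith
  · simp only [max_eq_right (show m - h₁ ≤ 0 by linarith),
      max_eq_right (show m - a₁ ≤ 0 by linarith), max_eq_right (show m - b₂ ≤ 0 by linarith),
      max_eq_right (show m - a₂ ≤ 0 by linarith), ← hD₁, ← hD₂]
    linarith

namespace BBetter

variable {Θ : Type*} [TopologicalSpace Θ] [MeasurableSpace Θ] [BorelSpace Θ] {a b ahat : C(Θ, ℝ)}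

theorem le_of_le (h : BBetter a b ahat) {x : Θ} (hx : b x ≤ a x) : b x ≤ ahat x := by
  have := (h id strictMono_id continuous_id (Measure.dirac x) inferInstance).1
  simp only [id, integral_dirac' _ _ (ContinuousMap.continuous _).stronglyMeasurable] at this
  exact this hx

theorem lt_of_lt (h : BBetter a b ahat) {x : Θ} (hx : b x < a x) : b x < ahat x := by
  have := (h id strictMono_id continuous_id (Measure.dirac x) inferInstance).2
  simp only [id, integral_dirac' _ _ (ContinuousMap.continuous _).stronglyMeasurable] at this
  exact this hx

/-- The two-state belief making the agent indifferent between `a` and `b` compares the relative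
gain of `ahat` in one state with its relative loss in the other. -/
theorem mul_le_mul (h : BBetter a b ahat) {u : ℝ → ℝ} (hu : StrictMono u) (hc : Continuous u)
    {x y : Θ} (hx : b x < a x) (hy : a y < b y) :
    (u (b y) - u (ahat y)) * (u (a x) - u (b x)) ≤
      (u (ahat x) - u (b x)) * (u (b y) - u (a y)) := by
  have hx' : 0 < u (a x) - u (b x) := sub_pos.2 (hu hx)
  have hy' : 0 < u (b y) - u (a y) := sub_pos.2 (hu hy)
  set s := u (a x) - u (b x) with hs
  set t := u (b y) - u (a y) with ht
  have hst : 0 < s + t := by positivity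
  obtain ⟨μ, hμ, hint⟩ := exists_isProbabilityMeasure_two_point x y
    (p := t / (s + t)) (by positivity) ((div_le_one hst).2 (by linarith))
  have hint' (f : C(Θ, ℝ)) :
      ∫ θ, u (f θ) ∂μ = (t * u (f x) + s * u (f y)) / (s + t) := by
    have : ∫ θ, u (f θ) ∂μ = t / (s + t) * u (f x) + (1 - t / (s + t)) * u (f y) :=
      hint ⟨fun θ => u (f θ), hc.comp f.continuous⟩
    rw [this]
    field_simp
    ring
  have key := (h u hu hc μ hμ).1
  simp only [hint', ge_iff_le, div_le_div_iff_of_pos_right hst] at key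
  have heq : t * u (b x) + s * u (b y) = t * u (a x) + s * u (a y) := by rw [hs, ht]; ring
  linarith [key heq.le]

theorem forall_le_or_forall_le (h : BBetter a b ahat) (hA : ∃ θ, b θ < a θ) :
    (∀ θ, a θ ≤ ahat θ) ∨ (∀ θ, b θ ≤ ahat θ) := by
  by_contra! hcon
  obtain ⟨⟨x, hx⟩, y, hy⟩ := hcon
  have hay : a y < b y := lt_of_not_ge fun hle => (h.le_of_le hle).not_gt hy
  by_cases hex : ∃ z, b z < a z ∧ ahat z < a z
  · obtain ⟨z, hbz, haz⟩ := hex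
    have hbz' := h.lt_of_lt hbz
    rcases le_or_gt (ahat y) (a y) with hle | hlt
    · have := h.mul_le_mul strictMono_id continuous_id hbz hay
      simp only [id] at this
      nlinarith [mul_pos (sub_pos.2 haz) (sub_pos.2 hay),
        mul_nonneg (sub_nonneg.2 hle) (sub_pos.2 hbz).le]
    · obtain ⟨u, hu, hc, hlt'⟩ := exists_utility_of_lt_of_lt hbz' haz hlt hy
      exact (h.mul_le_mul hu hc hbz hay).not_gt hlt'
  · push Not at hex
    obtain ⟨z, hz⟩ := hA
    have hax : a x < b x := lt_of_not_ge fun hle => by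
      rcases hle.lt_or_eq with hlt | heq
      · exact (hex x hlt).not_gt hx
      · exact (h.le_of_le hle).not_gt (heq ▸ hx)
    obtain ⟨u, hu, hc, hlt⟩ := exists_utility_of_le_of_lt hz (hex z hz) hx hax
    exact (h.mul_le_mul hu hc hz hax).not_gt hlt

end BBetter

section Sufficiency

variable {Θ : Type*} [TopologicalSpace Θ] [CompactSpace Θ] [MeasurableSpace Θ] [BorelSpace Θ]

theorem integrable_comp_continuousMap {u : ℝ → ℝ} (hu : Continuous u) (f : C(Θ, ℝ))
    (μ : Measure Θ) [IsFiniteMeasure μ] : Integrable (fun θ => u (f θ)) μ :=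
  BoundedContinuousFunction.integrable μ
    (BoundedContinuousFunction.mkOfCompact ⟨fun θ => u (f θ), hu.comp f.continuous⟩)

theorem BBetter.of_forall_le {a b ahat : C(Θ, ℝ)} (h : ∀ θ, a θ ≤ ahat θ) :
    BBetter a b ahat := by
  intro u hu hc μ hμ
  have hle : ∫ θ, u (a θ) ∂μ ≤ ∫ θ, u (ahat θ) ∂μ :=
    integral_mono (integrable_comp_continuousMap hc a μ) (integrable_comp_continuousMap hc ahat μ)
      fun θ => hu.monotone (h θ)
  exact ⟨fun h' => h'.trans hle, fun h' => lt_of_lt_of_le h' hle⟩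

theorem BBetter.of_forall_lt_of_forall_le {a b ahat : C(Θ, ℝ)}
    (hlt : ∀ θ, b θ < a θ → b θ < ahat θ) (h : ∀ θ, b θ ≤ ahat θ) : BBetter a b ahat := by
  intro u hu hc μ hμ
  have hia := integrable_comp_continuousMap hc a μ
  have hib := integrable_comp_continuousMap hc b μ
  have hih := integrable_comp_continuousMap hc ahat μ
  have hmono : (fun θ => u (b θ)) ≤ fun θ => u (ahat θ) := fun θ => hu.monotone (h θ)
  have hle : ∫ θ, u (b θ) ∂μ ≤ ∫ θ, u (ahat θ) ∂μ := integral_mono hib hih hmono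
  refine ⟨fun _ => hle, fun h' => hle.lt_of_ne fun heq => ?_⟩
  have hae : (fun θ => u (b θ)) =ᵐ[μ] fun θ => u (ahat θ) :=
    (integral_eq_iff_of_ae_le hib hih (Filter.Eventually.of_forall hmono)).1 heq
  refine (integral_mono_ae hia hib ?_).not_gt h'
  filter_upwards [hae] with θ hθ
  exact hu.monotone (le_of_not_gt fun hgt => (hu (hlt θ hgt)).ne hθ)

end Sufficiency

/-- Theorem 2: `ahat` is b-better than `a` iff `ahat θ > b θ` on 𝒜 and `ahat`
state-wise dominates `a` or `b`. -/
theorem bBetter_iff {Θ : Type*} [TopologicalSpace Θ] [CompactSpace Θ]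
    [TopologicalSpace.MetrizableSpace Θ] [MeasurableSpace Θ] [BorelSpace Θ]
    (a b ahat : C(Θ, ℝ))
    (hA : ∃ θ, a θ > b θ) (hB : ∃ θ, a θ < b θ) :
    BBetter a b ahat ↔
      ((∀ θ, a θ > b θ → ahat θ > b θ) ∧
        ((∀ θ, ahat θ ≥ a θ) ∨ (∀ θ, ahat θ ≥ b θ))) := by
  constructor
  · exact fun h => ⟨fun θ => h.lt_of_lt, h.forall_le_or_forall_le hA⟩
  · rintro ⟨hlt, h | h⟩
    · exact .of_forall_le h
    · exact .of_forall_lt_of_forall_le hlt h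
end

section
/- Let L_a, L_â, L_1, …, L_m be simple lotteries (m ≥ 1). L_â B-improves upon L_a with respect to the class of strictly increasing, continuous utilities if and only if for every b ∈ {1, …, m} there exists a convex weight λ ∈ ℝ^m such that the lottery Σ_{i=1}^m λ_i L_i + (1 − Σ_{i=1}^m λ_i) L_â dominates the lottery Σ_{i=1}^m λ_i L_a + (1 − Σ_{i=1}^m λ_i) L_b in the sense that every strictly increasing, continuous u : ℝ → ℝ gives the former weakly higher expected utility than the latter (first-order stochastic dominance). -/
open MeasureTheory

/-- A simple lottery: a finitely supported Borel probability measure on ℝ. -/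
def SimpleLottery (L : Measure ℝ) : Prop :=
  IsProbabilityMeasure L ∧ ∃ s : Finset ℝ, L ((s : Set ℝ))ᶜ = 0

/-- A convex weight: nonnegative entries summing to at most one. -/
def ConvexWeight {m : ℕ} (l : Fin m → ℝ) : Prop :=
  (∀ i, 0 ≤ l i) ∧ ∑ i, l i ≤ 1

/-- The convex combination `∑ i, l i • Ls i + (1 - ∑ i, l i) • L` of measures. -/
noncomputable def mixLottery {m : ℕ} (l : Fin m → ℝ) (Ls : Fin m → Measure ℝ)
    (L : Measure ℝ) : Measure ℝ :=
  (∑ i, ENNReal.ofReal (l i) • Ls i) + ENNReal.ofReal (1 - ∑ i, l i) • L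

theorem SimpleLottery.integrable {L : Measure ℝ} (hL : SimpleLottery L) (u : ℝ → ℝ) :
    Integrable u L := by
  obtain ⟨hp, s, hs⟩ := hL
  rw [← Measure.restrict_eq_self_of_ae_mem (μ := L) (s := (s : Set ℝ)) (by
    rwa [ae_iff])]
  exact IntegrableOn.finset

theorem integral_mixLottery {m : ℕ} {l : Fin m → ℝ} (hl : ConvexWeight l)
    {Ls : Fin m → Measure ℝ} {L : Measure ℝ} (hLs : ∀ i, SimpleLottery (Ls i))
    (hL : SimpleLottery L) (u : ℝ → ℝ) :
    ∫ x, u x ∂(mixLottery l Ls L) =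
      ∑ i, l i * ∫ x, u x ∂(Ls i) + (1 - ∑ i, l i) * ∫ x, u x ∂L := by
  have hi : ∀ i ∈ Finset.univ, Integrable u (ENNReal.ofReal (l i) • Ls i) := fun i _ =>
    ((hLs i).integrable u).smul_measure ENNReal.ofReal_ne_top
  rw [mixLottery, integral_add_measure (integrable_finsetSum_measure.2 hi)
    ((hL.integrable u).smul_measure ENNReal.ofReal_ne_top), integral_finsetSum_measure hi]
  simp only [integral_smul_measure, smul_eq_mul, ENNReal.toReal_ofReal (hl.1 _),
    ENNReal.toReal_ofReal (sub_nonneg.2 hl.2)]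

/-- A convex cone of real vectors containing no positive vector lies in a half-space whose
normal is a probability vector. -/
theorem ConvexCone.exists_weights_of_exists_nonpos {ι : Type*} [Fintype ι]
    (C : ConvexCone ℝ (ι → ℝ)) (hne : (C : Set (ι → ℝ)).Nonempty)
    (hC : ∀ c ∈ C, ∃ i, c i ≤ 0) :
    ∃ w : ι → ℝ, (∀ i, 0 ≤ w i) ∧ ∑ i, w i = 1 ∧ ∀ c ∈ C, ∑ i, w i * c i ≤ 0 := by
  classical
  have hP : Set.univ.pi (fun _ : ι => Set.Ioi (0 : ℝ)) = {v | ∀ i, 0 < v i} := by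
    ext v; simp
  have hconv : Convex ℝ {v : ι → ℝ | ∀ i, 0 < v i} :=
    hP ▸ convex_pi fun _ _ => convex_Ioi 0
  have hopen : IsOpen {v : ι → ℝ | ∀ i, 0 < v i} :=
    hP ▸ isOpen_set_pi Set.finite_univ fun _ _ => isOpen_Ioi
  have hdisj : Disjoint {v : ι → ℝ | ∀ i, 0 < v i} (C : Set (ι → ℝ)) :=
    Set.disjoint_left.2 fun v hv hvC => by
      obtain ⟨i, hi⟩ := hC v hvC
      exact (hv i).not_ge hi
  obtain ⟨f, s, hfP, hfC⟩ := geometric_hahn_banach_open hconv hopen C.convex hdisj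
  have hs_nonneg : 0 ≤ s := by
    have h : Filter.Tendsto (fun t : ℝ => f (t • (1 : ι → ℝ))) (nhdsWithin 0 (Set.Ioi 0))
        (nhds 0) := by
      have : Continuous fun t : ℝ => f (t • (1 : ι → ℝ)) := by fun_prop
      simpa using (this.tendsto 0).mono_left nhdsWithin_le_nhds
    refine le_of_tendsto h ?_
    filter_upwards [self_mem_nhdsWithin] with t ht
    exact (hfP _ fun i => by simpa using ht).le
  have hs_nonpos : s ≤ 0 := by
    obtain ⟨c, hc⟩ := hne
    have h : Filter.Tendsto (fun t : ℝ => f (t • c)) (nhdsWithin 0 (Set.Ioi 0)) (nhds 0) := by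
      have : Continuous fun t : ℝ => f (t • c) := by fun_prop
      simpa using (this.tendsto 0).mono_left nhdsWithin_le_nhds
    refine ge_of_tendsto h ?_
    filter_upwards [self_mem_nhdsWithin] with t ht
    exact hfC _ (C.smul_mem ht hc)
  obtain rfl : s = 0 := le_antisymm hs_nonpos hs_nonneg
  have hf : ∀ v, f v = ∑ i, v i * f (Pi.single i 1) := fun v => by
    conv_lhs => rw [pi_eq_sum_univ' v]
    simp
  have hcoef : ∀ i, f (Pi.single i 1) ≤ 0 := fun i => by
    have h : Filter.Tendsto (fun t : ℝ => f (Pi.single i 1 + t • (1 : ι → ℝ)))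
        (nhdsWithin 0 (Set.Ioi 0)) (nhds (f (Pi.single i 1))) := by
      have : Continuous fun t : ℝ => f (Pi.single i 1 + t • (1 : ι → ℝ)) := by fun_prop
      simpa using (this.tendsto 0).mono_left nhdsWithin_le_nhds
    refine le_of_tendsto h ?_
    filter_upwards [self_mem_nhdsWithin] with t ht
    refine (hfP _ fun j => ?_).le
    have h0 : (0 : ι → ℝ) ≤ Pi.single i 1 := Pi.single_nonneg.2 zero_le_one
    have h1 : (0 : ℝ) ≤ (Pi.single i 1 : ι → ℝ) j := h0 j
    have h2 : (0 : ℝ) < t := ht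
    simp only [Pi.add_apply, Pi.smul_apply, Pi.one_apply, smul_eq_mul, mul_one]
    linarith
  have hf1 : f 1 < 0 := hfP 1 fun _ => one_pos
  refine ⟨fun i => f (Pi.single i 1) / f 1, fun i => div_nonneg_of_nonpos (hcoef i) hf1.le,
    ?_, fun c hc => ?_⟩
  · rw [← Finset.sum_div, div_eq_one_iff_eq hf1.ne, hf 1]
    simp
  · have : ∑ i, f (Pi.single i 1) / f 1 * c i = f c / f 1 := by
      rw [hf c, Finset.sum_div]
      exact Finset.sum_congr rfl fun i _ => by ring
    rw [this]
    exact div_nonpos_of_nonneg_of_nonpos (hfC c hc) hf1.le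

/-- Theorem 3 (monotone class): `L_ahat` B-improves upon `L_a` iff for each `b`
there is a convex weight `λ` such that `∑ λ_i L_i + (1-∑λ_i) L_ahat`
first-order stochastically dominates `∑ λ_i L_a + (1-∑λ_i) L_b`. -/
theorem lottery_improvement_iff_monotone {m : ℕ} (hm : 1 ≤ m)
    (La Lh : Measure ℝ) (Ls : Fin m → Measure ℝ)
    (hLa : SimpleLottery La) (hLh : SimpleLottery Lh)
    (hLs : ∀ i, SimpleLottery (Ls i)) :
    (∀ u : ℝ → ℝ, StrictMono u → Continuous u →
      (∀ i, (∫ x, u x ∂La) > ∫ x, u x ∂(Ls i)) →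
      (∀ i, (∫ x, u x ∂Lh) ≥ ∫ x, u x ∂(Ls i))) ↔
    (∀ b : Fin m, ∃ l : Fin m → ℝ, ConvexWeight l ∧
      ∀ u : ℝ → ℝ, StrictMono u → Continuous u →
        (∫ x, u x ∂(mixLottery l Ls Lh)) ≥
          ∫ x, u x ∂(mixLottery l (fun _ => La) (Ls b))) := by
  constructor
  · intro h b
    let gain (u : ℝ → ℝ) : Option (Fin m) → ℝ := fun o =>
      o.elim (∫ x, u x ∂(Ls b) - ∫ x, u x ∂Lh) fun i => ∫ x, u x ∂La - ∫ x, u x ∂(Ls i)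
    let C : ConvexCone ℝ (Option (Fin m) → ℝ) :=
      { carrier := {c | ∃ u, StrictMono u ∧ Continuous u ∧ gain u = c}
        smul_mem' := by
          rintro t ht _ ⟨u, hu, huc, rfl⟩
          refine ⟨fun x => t * u x, hu.const_mul ht, continuous_const.mul huc, ?_⟩
          ext o
          cases o <;> simp [gain, integral_const_mul, mul_sub]
        add_mem' := by
          rintro _ ⟨u, hu, huc, rfl⟩ _ ⟨v, hv, hvc, rfl⟩
          refine ⟨fun x => u x + v x, hu.add hv, huc.add hvc, ?_⟩
          ext o
          cases o <;>
            simp [gain, integral_add, hLa.integrable, hLh.integrable, (hLs _).integrable] <;>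
            ring }
    obtain ⟨w, hw, hw1, hwC⟩ := C.exists_weights_of_exists_nonpos
      ⟨_, id, strictMono_id, continuous_id, rfl⟩ (by
        rintro _ ⟨u, hu, huc, rfl⟩
        by_contra! hpos
        have hb := h u hu huc (fun i => sub_pos.1 (hpos (some i))) b
        exact (sub_pos.1 (hpos none)).not_ge hb)
    rw [Fintype.sum_option] at hw1
    have hl : ConvexWeight fun i => w (some i) :=
      ⟨fun i => hw _, by linarith [hw none]⟩
    refine ⟨fun i => w (some i), hl, fun u hu huc => ?_⟩
    have hu0 := hwC _ ⟨u, hu, huc, rfl⟩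
    rw [Fintype.sum_option] at hu0
    simp only [gain, Option.elim, mul_sub, Finset.sum_sub_distrib] at hu0
    rw [integral_mixLottery hl hLs hLh, integral_mixLottery hl (fun _ => hLa) (hLs b),
      ← eq_sub_of_add_eq hw1]
    linarith
  · intro h u hu huc ha b
    obtain ⟨l, hl, hlu⟩ := h b
    have hdom := hlu u hu huc
    rw [integral_mixLottery hl hLs hLh, integral_mixLottery hl (fun _ => hLa) (hLs b)] at hdom
    have hle : ∀ i ∈ Finset.univ, l i * ∫ x, u x ∂(Ls i) ≤ l i * ∫ x, u x ∂La :=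
      fun i _ => mul_le_mul_of_nonneg_left (ha i).le (hl.1 i)
    rcases hl.2.lt_or_eq with hlt | heq
    · have := Finset.sum_le_sum hle
      exact le_of_mul_le_mul_left (by linarith) (sub_pos.2 hlt)
    · obtain ⟨i, hi, hi0⟩ : ∃ i ∈ Finset.univ, 0 < l i :=
        Finset.exists_lt_of_sum_lt (by simp [heq])
      have := Finset.sum_lt_sum hle ⟨i, hi, mul_lt_mul_of_pos_left (ha i) hi0⟩
      rw [heq] at hdom
      linarith
end
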